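/- Let G, H be positive semidefinite matrices with trace(G²) = trace(H²) = 1, and let s ∈ [0,1], 1 ≤ p ≤ 2. Then (trace(GH))² · trace((s·G^p + (1-s)·H^p)^(2/p)) ≤ (trace(G·(s·G^p + (1-s)·H^p)^(1/p)))². -/

import Mathlib

open Matrix MeasureTheory
open scoped ComplexOrder

/-- Apply a real function to a Hermitian matrix via the spectral decomposition. -/
noncomputable def matFun {n : ℕ} (A : Matrix (Fin n) (Fin n) ℂ) (hA : A.IsHermitian)
    (g : ℝ → ℝ) : Matrix (Fin n) (Fin n) ℂ :=
  (hA.eigenvectorUnitary : Matrix (Fin n) (Fin n) ℂ) *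
    Matrix.diagonal (fun i => (g (hA.eigenvalues i) : ℂ)) *
    star (hA.eigenvectorUnitary : Matrix (Fin n) (Fin n) ℂ)

/-- Real power of a Hermitian matrix via the spectral decomposition. -/
noncomputable def mpow {n : ℕ} (A : Matrix (Fin n) (Fin n) ℂ) (hA : A.IsHermitian)
    (p : ℝ) : Matrix (Fin n) (Fin n) ℂ :=
  matFun A hA (fun x => x ^ p)

/-- Hilbert-Schmidt (Frobenius) norm of a matrix. -/
noncomputable def frob {n : ℕ} (X : Matrix (Fin n) (Fin n) ℂ) : ℝ :=
  Real.sqrt (Matrix.trace (star X * X)).re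

section MatrixPowers

open scoped MatrixOrder

variable {n : ℕ}

lemma matFun_eq_cfc (A : Matrix (Fin n) (Fin n) ℂ) (hA : A.IsHermitian) (g : ℝ → ℝ) :
    matFun A hA g = cfc g A := by
  rw [hA.cfc_eq, Matrix.IsHermitian.cfc, Unitary.conjStarAlgAut_apply]
  rfl

lemma mpow_eq_rpow (A : Matrix (Fin n) (Fin n) ℂ) (hA : A.PosSemidef) (p : ℝ) :
    mpow A hA.1 p = A ^ p := by
  rw [mpow, matFun_eq_cfc, CFC.rpow_eq_cfc_real hA.nonneg]

lemma trace_matFun (A : Matrix (Fin n) (Fin n) ℂ) (hA : A.IsHermitian) (g : ℝ → ℝ) :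
    (trace (matFun A hA g)).re = ∑ i, g (hA.eigenvalues i) := by
  rw [matFun, trace_mul_comm, ← mul_assoc, Unitary.coe_star_mul_self, one_mul, trace_diagonal]
  simp

lemma mul_self_eq_matFun (A : Matrix (Fin n) (Fin n) ℂ) (hA : A.IsHermitian) :
    A * A = matFun A hA (fun x => x ^ (2 : ℝ)) := by
  have h : (fun x : ℝ => x ^ (2 : ℝ)) = fun x => x ^ 2 := by
    ext x
    exact Real.rpow_two x
  rw [matFun_eq_cfc, h, cfc_pow_id A 2 hA.isSelfAdjoint, pow_two]

lemma re_mul_diagonal_mul_star_apply (W : Matrix (Fin n) (Fin n) ℂ) (d : Fin n → ℝ) (i : Fin n) :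
    ((W * diagonal (fun j => (d j : ℂ)) * star W) i i).re = ∑ j, Complex.normSq (W i j) * d j := by
  rw [mul_apply, Complex.re_sum]
  refine Finset.sum_congr rfl fun j _ => ?_
  rw [mul_diagonal, star_apply, mul_right_comm, RCLike.star_def, Complex.mul_conj,
    ← Complex.ofReal_mul, Complex.ofReal_re]

lemma re_conj_matFun_apply (A : Matrix (Fin n) (Fin n) ℂ) (hA : A.IsHermitian) (g : ℝ → ℝ)
    (V : Matrix (Fin n) (Fin n) ℂ) (i : Fin n) :
    ((star V * matFun A hA g * V) i i).re =
      ∑ j, Complex.normSq ((star V * (hA.eigenvectorUnitary : Matrix (Fin n) (Fin n) ℂ)) i j) *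
        g (hA.eigenvalues j) := by
  rw [← re_mul_diagonal_mul_star_apply, matFun, star_mul, star_star]
  simp only [mul_assoc]

lemma sum_normSq_of_mul_star_self (W : Matrix (Fin n) (Fin n) ℂ) (hW : W * star W = 1)
    (i : Fin n) : ∑ j, Complex.normSq (W i j) = 1 := by
  simpa [hW] using (re_mul_diagonal_mul_star_apply W (fun _ => 1) i).symm

lemma star_mul_eigenvectorUnitary_mul_star_self (A : Matrix (Fin n) (Fin n) ℂ)
    (hA : A.IsHermitian) (V : unitaryGroup (Fin n) ℂ) :
    (star (V : Matrix (Fin n) (Fin n) ℂ) * hA.eigenvectorUnitary) *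
      star (star (V : Matrix (Fin n) (Fin n) ℂ) * hA.eigenvectorUnitary) = 1 :=
  Unitary.coe_mul_star_self (star V * hA.eigenvectorUnitary)

/-- Jensen's inequality for a diagonal entry of a unitarily conjugated power. -/
lemma rpow_re_conj_mpow_apply_le (A : Matrix (Fin n) (Fin n) ℂ) (hA : A.PosSemidef)
    {p : ℝ} (hp : p ∈ Set.Icc (1 : ℝ) 2) (V : unitaryGroup (Fin n) ℂ) (i : Fin n) :
    0 ≤ ((star (V : Matrix (Fin n) (Fin n) ℂ) * mpow A hA.1 p * V) i i).re ∧
    ((star (V : Matrix (Fin n) (Fin n) ℂ) * mpow A hA.1 p * V) i i).re ^ (2 / p) ≤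
      ((star (V : Matrix (Fin n) (Fin n) ℂ) * (A * A) * V) i i).re := by
  have hp0 : 0 < p := by linarith [hp.1]
  have hpow (j) : 0 ≤ hA.1.eigenvalues j ^ p := Real.rpow_nonneg (hA.eigenvalues_nonneg j) p
  rw [mul_self_eq_matFun A hA.1, mpow, re_conj_matFun_apply, re_conj_matFun_apply]
  refine ⟨Finset.sum_nonneg fun j _ => mul_nonneg (Complex.normSq_nonneg _) (hpow j), ?_⟩
  refine (Real.rpow_arith_mean_le_arith_mean_rpow _ _ _ (fun j _ => Complex.normSq_nonneg _)
    (sum_normSq_of_mul_star_self _ (star_mul_eigenvectorUnitary_mul_star_self A hA.1 V) i)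
    (fun j _ => hpow j) ((one_le_div hp0).2 hp.2)).trans_eq ?_
  refine Finset.sum_congr rfl fun j _ => ?_
  rw [← Real.rpow_mul (hA.eigenvalues_nonneg j), mul_div_cancel₀ _ hp0.ne']

lemma sum_re_conj_apply (A : Matrix (Fin n) (Fin n) ℂ) (V : unitaryGroup (Fin n) ℂ) :
    ∑ i, ((star (V : Matrix (Fin n) (Fin n) ℂ) * A * V) i i).re = (trace A).re := by
  have h : trace (star (V : Matrix (Fin n) (Fin n) ℂ) * A *
      (V : Matrix (Fin n) (Fin n) ℂ)) = trace A := by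
    rw [trace_mul_comm, ← mul_assoc, ← Unitary.coe_star, Unitary.coe_mul_star_self, one_mul]
  rw [← h, trace, Complex.re_sum]
  rfl

lemma eigenvalues_eq_re_conj_apply (A : Matrix (Fin n) (Fin n) ℂ) (hA : A.IsHermitian)
    (i : Fin n) :
    hA.eigenvalues i = ((star (hA.eigenvectorUnitary : Matrix (Fin n) (Fin n) ℂ) * A *
      hA.eigenvectorUnitary) i i).re := by
  have h : matFun A hA id = A := by
    rw [matFun_eq_cfc, cfc_id ℝ A hA.isSelfAdjoint]
  have h' := re_conj_matFun_apply A hA id hA.eigenvectorUnitary i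
  rw [h, Unitary.coe_star_mul_self] at h'
  rw [h']
  simp [one_apply, apply_ite Complex.normSq]

/-- Trace convexity: the power mean of two positive semidefinite matrices has Hilbert-Schmidt
norm at most the mean of the norms. -/
lemma trace_mpow_powerMean_le (G H : Matrix (Fin n) (Fin n) ℂ)
    (hG : G.PosSemidef) (hH : H.PosSemidef) {s p : ℝ} (hs : s ∈ Set.Icc (0 : ℝ) 1)
    (hp : p ∈ Set.Icc (1 : ℝ) 2)
    (hK : (s • mpow G hG.1 p + (1 - s) • mpow H hH.1 p).IsHermitian) :
    (trace (mpow _ hK (2 / p))).re ≤ s * (trace (G * G)).re + (1 - s) * (trace (H * H)).re := by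
  have hp0 : 0 < p := by linarith [hp.1]
  have hs' : 0 ≤ 1 - s := sub_nonneg.2 hs.2
  rw [mpow, trace_matFun, ← sum_re_conj_apply (G * G) hK.eigenvectorUnitary,
    ← sum_re_conj_apply (H * H) hK.eigenvectorUnitary, Finset.mul_sum, Finset.mul_sum,
    ← Finset.sum_add_distrib]
  refine Finset.sum_le_sum fun i _ => ?_
  obtain ⟨hG0, hGle⟩ := rpow_re_conj_mpow_apply_le G hG hp hK.eigenvectorUnitary i
  obtain ⟨hH0, hHle⟩ := rpow_re_conj_mpow_apply_le H hH hp hK.eigenvectorUnitary i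
  have hconv := (convexOn_rpow ((one_le_div hp0).2 hp.2)).2 hG0 hH0 hs.1 hs' (by ring)
  have hsplit : hK.eigenvalues i =
      s * ((star (hK.eigenvectorUnitary : Matrix (Fin n) (Fin n) ℂ) * mpow G hG.1 p *
        hK.eigenvectorUnitary) i i).re +
      (1 - s) * ((star (hK.eigenvectorUnitary : Matrix (Fin n) (Fin n) ℂ) * mpow H hH.1 p *
        hK.eigenvectorUnitary) i i).re := by
    rw [eigenvalues_eq_re_conj_apply _ hK i]
    simp only [mul_add, add_mul, mul_smul_comm, smul_mul_assoc, Matrix.add_apply, Matrix.smul_apply,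
      Complex.add_re, Complex.smul_re, smul_eq_mul]
  rw [hsplit]
  simp only [smul_eq_mul] at hconv
  exact hconv.trans (add_le_add (mul_le_mul_of_nonneg_left hGle hs.1)
    (mul_le_mul_of_nonneg_left hHle hs'))

lemma re_trace_mul_nonneg {A B : Matrix (Fin n) (Fin n) ℂ}
    (hA : A.PosSemidef) (hB : B.PosSemidef) : 0 ≤ (trace (A * B)).re := by
  obtain ⟨C, rfl⟩ := CStarAlgebra.nonneg_iff_eq_star_mul_self.mp hA.nonneg
  rw [mul_assoc, trace_mul_comm]
  exact (Complex.le_def.1 (hB.mul_mul_conjTranspose_same C).trace_nonneg).1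

open scoped Norms.L2Operator in
/-- Operator concavity of `x ↦ x ^ (1 / p)`. -/
lemma smul_add_smul_le_mpow (G H : Matrix (Fin n) (Fin n) ℂ)
    (hG : G.PosSemidef) (hH : H.PosSemidef) {s p : ℝ} (hs : s ∈ Set.Icc (0 : ℝ) 1)
    (hp : 1 ≤ p) (hK : (s • mpow G hG.1 p + (1 - s) • mpow H hH.1 p).IsHermitian) :
    s • G + (1 - s) • H ≤ mpow _ hK (1 / p) := by
  have hp0 : 0 < p := by linarith
  have hs' : 0 ≤ 1 - s := sub_nonneg.2 hs.2
  have hroot {A : Matrix (Fin n) (Fin n) ℂ} (hA : A.PosSemidef) : (A ^ p) ^ (1 / p) = A := by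
    rw [CFC.rpow_rpow_of_exponent_nonneg A p (1 / p) hp0.le (by positivity) hA.nonneg,
      mul_one_div_cancel hp0.ne', CFC.rpow_one A hA.nonneg]
  have hKpos : (s • mpow G hG.1 p + (1 - s) • mpow H hH.1 p).PosSemidef := by
    rw [mpow_eq_rpow G hG, mpow_eq_rpow H hH, ← nonneg_iff_posSemidef]
    exact add_nonneg (smul_nonneg hs.1 CFC.rpow_nonneg) (smul_nonneg hs' CFC.rpow_nonneg)
  have hconc := (CFC.concaveOn_rpow (A := Matrix (Fin n) (Fin n) ℂ) (p := 1 / p)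
    ⟨by positivity, (div_le_one hp0).2 hp⟩).2
    (Set.mem_Ici.2 (CFC.rpow_nonneg (a := G) (y := p)))
    (Set.mem_Ici.2 (CFC.rpow_nonneg (a := H) (y := p))) hs.1 hs' (by ring)
  simp only [hroot hG, hroot hH] at hconc
  rw [mpow_eq_rpow _ hKpos, mpow_eq_rpow G hG, mpow_eq_rpow H hH]
  exact hconc

end MatrixPowers

theorem stmt8 {n : ℕ} (G H : Matrix (Fin n) (Fin n) ℂ)
    (hG : G.PosSemidef) (hH : H.PosSemidef)
    (hG2 : (Matrix.trace (G * G)).re = 1) (hH2 : (Matrix.trace (H * H)).re = 1)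
    (s p : ℝ) (hs : s ∈ Set.Icc (0:ℝ) 1) (hp : p ∈ Set.Icc (1:ℝ) 2)
    (hK : (s • mpow G hG.1 p + (1 - s) • mpow H hH.1 p).IsHermitian) :
    (Matrix.trace (G * H)).re ^ 2 * (Matrix.trace (mpow _ hK (2/p))).re ≤
      (Matrix.trace (G * mpow _ hK (1/p))).re ^ 2 := by
  have ht0 : 0 ≤ (trace (G * H)).re := re_trace_mul_nonneg hG hH
  have ht1 : (trace (G * H)).re ≤ 1 := by
    have h : 0 ≤ (trace ((G - H)ᴴ * (G - H))).re :=
      (Complex.le_def.1 (posSemidef_conjTranspose_mul_self (G - H)).trace_nonneg).1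
    rw [(hG.1.sub hH.1).eq, sub_mul, mul_sub, mul_sub, trace_sub, trace_sub, trace_sub,
      trace_mul_comm H G] at h
    simp only [Complex.sub_re] at h
    linarith
  have hnorm : (trace (mpow _ hK (2 / p))).re ≤ 1 := by
    have h := trace_mpow_powerMean_le G H hG hH hs hp hK
    rw [hG2, hH2] at h
    linarith
  have hlow : (trace (G * H)).re ≤ (trace (G * mpow _ hK (1 / p))).re := by
    have h := re_trace_mul_nonneg hG (le_iff.1 (smul_add_smul_le_mpow G H hG hH hs hp.1 hK))
    simp only [mul_sub, mul_add, mul_smul_comm, trace_sub, trace_add, trace_smul, Complex.sub_re,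
      Complex.add_re, Complex.smul_re, smul_eq_mul, hG2] at h
    nlinarith [mul_nonneg hs.1 (sub_nonneg.2 ht1)]
  calc (trace (G * H)).re ^ 2 * (trace (mpow _ hK (2 / p))).re
      ≤ (trace (G * H)).re ^ 2 := mul_le_of_le_one_right (sq_nonneg _) hnorm
    _ ≤ _ := pow_le_pow_left₀ ht0 hlow 2
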